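/- Let G be a finitely generated group containing a nilpotent subgroup of finite index, let A be a finite subgroup of Aut(G), and let g, h ∈ G. Put T = {a(g) : a ∈ A} and ξ(r) = Nat.card (π '' (h · W_r(T))), the number of A-orbits meeting the set h·W_r(T). Then there exist a constant C > 0 and a natural number k such that ξ(r) ≤ C·r^k for all r ≥ 1. In other words, every n-valued dynamic T_z on the coset group X = (G, A) has a polynomial growth function at every point. -/

import Mathlib

variable {G : Type*} [Group G]

/-- `W T r`: the set of products of exactly `r` elements of `T` (with `W T 0 = {1}`). -/
def wordSet (T : Set G) (r : ℕ) : Set G :=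
  {x | ∃ l : List G, l.length = r ∧ (∀ t ∈ l, t ∈ T) ∧ l.prod = x}

/-- The monoid ball `B⁺_T(r) = ⋃_{m=0}^{r} W_m(T)`. -/
def monoidBall (T : Set G) (r : ℕ) : Set G :=
  {x | ∃ l : List G, l.length ≤ r ∧ (∀ t ∈ l, t ∈ T) ∧ l.prod = x}

/-- The monoid sphere `S⁺_T(r) = B⁺_T(r) \ B⁺_T(r-1)`. -/
def monoidSphere (T : Set G) (r : ℕ) : Set G := monoidBall T r \ monoidBall T (r - 1)

/-- `π : G → G/A`, sending `g` to its `A`-orbit `{a(g) : a ∈ A}`. -/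
def orbitMap (A : Subgroup (MulAut G)) : G → Set G :=
  fun g => {x | ∃ a ∈ A, a g = x}

/-- The balls of the submonoid generated by `S` grow at most polynomially. -/
def HasPolynomialMonoidGrowth (S : Set G) : Prop :=
  ∃ C k : ℕ, ∀ r : ℕ, (monoidBall S r).encard ≤ ((C * (r + 1) ^ k : ℕ) : ℕ∞)

theorem one_mem_monoidBall (S : Set G) (r : ℕ) : (1 : G) ∈ monoidBall S r :=
  ⟨[], by simp, by simp, rfl⟩

theorem mem_monoidBall_one {S : Set G} {s : G} (hs : s ∈ S) : s ∈ monoidBall S 1 :=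
  ⟨[s], by simp, by simpa using hs, by simp⟩

theorem monoidBall_mono {S S' : Set G} (hS : S ⊆ S') {r r' : ℕ} (hr : r ≤ r') :
    monoidBall S r ⊆ monoidBall S' r' := by
  rintro x ⟨l, hl, hlS, rfl⟩
  exact ⟨l, hl.trans hr, fun t ht => hS (hlS t ht), rfl⟩

theorem mul_mem_monoidBall {S : Set G} {x y : G} {m n : ℕ} (hx : x ∈ monoidBall S m)
    (hy : y ∈ monoidBall S n) : x * y ∈ monoidBall S (m + n) := by
  obtain ⟨l, hl, hlS, rfl⟩ := hx
  obtain ⟨l', hl', hlS', rfl⟩ := hy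
  refine ⟨l ++ l', by simp; omega, fun t ht => ?_, by simp⟩
  rcases List.mem_append.1 ht with h | h
  exacts [hlS t h, hlS' t h]

theorem HasPolynomialMonoidGrowth.mono {S S' : Set G} (h : HasPolynomialMonoidGrowth S')
    (hS : S ⊆ S') : HasPolynomialMonoidGrowth S := by
  obtain ⟨C, k, hC⟩ := h
  exact ⟨C, k, fun r => (Set.encard_le_encard (monoidBall_mono hS le_rfl)).trans (hC r)⟩

theorem encard_image2_le_mul {α β γ : Type*} (f : α → β → γ) (s : Set α) (t : Set β) :
    (Set.image2 f s t).encard ≤ s.encard * t.encard := by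
  rw [← Set.image_uncurry_prod, ← Set.encard_prod]
  exact Set.encard_image_le _ _

/-- The right difference `s⁻¹ (t⁻¹ s t)` between `s` and its conjugate by `t`. -/
def conjDiff (t s : G) : G := s⁻¹ * (t⁻¹ * s * t)

theorem conj_pow_mem_monoidBall {t : G} {S : Set G} (m : ℕ) {s : G}
    (hS : ∀ j < m, (conjDiff t)^[j] s ∈ S) (hm : (conjDiff t)^[m] s = 1) (e : ℕ) :
    (t ^ e)⁻¹ * s * t ^ e ∈ monoidBall S ((e + 1) ^ m) := by
  induction m generalizing s e with
  | zero =>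
    obtain rfl : s = 1 := hm
    simpa using one_mem_monoidBall S _
  | succ m ihm =>
    induction e with
    | zero => simpa using mem_monoidBall_one (hS 0 (by omega))
    | succ e ihe =>
      have hD := ihm (s := conjDiff t s) (fun j hj => hS (j + 1) (by omega)) hm e
      have hlen : (e + 1) ^ (m + 1) + (e + 1) ^ m ≤ (e + 1 + 1) ^ (m + 1) := by
        have : (e + 1) ^ m ≤ (e + 1 + 1) ^ m := Nat.pow_le_pow_left (by omega) m
        calc (e + 1) ^ (m + 1) + (e + 1) ^ m = (e + 1) ^ m * (e + 1 + 1) := by ring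
          _ ≤ (e + 1 + 1) ^ m * (e + 1 + 1) := Nat.mul_le_mul_right _ this
          _ = _ := by ring
      convert monoidBall_mono subset_rfl hlen (mul_mem_monoidBall ihe hD) using 1
      rw [conjDiff, pow_succ' t e]
      group

theorem monoidBall_insert_subset {t : G} {S S' : Set G} (m : ℕ)
    (hS : ∀ s ∈ S, ∀ j < m, (conjDiff t)^[j] s ∈ S')
    (hm : ∀ s ∈ S, (conjDiff t)^[m] s = 1) (r : ℕ) :
    monoidBall (insert t S) r ⊆
      Set.image2 (fun e x => t ^ e * x) (Set.Iic r) (monoidBall S' (r * (r + 1) ^ m)) := by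
  rintro x ⟨l, hl, hlS, rfl⟩
  induction l generalizing r with
  | nil => exact ⟨0, by simp, 1, one_mem_monoidBall _ _, by simp⟩
  | cons s l ih =>
    obtain ⟨r, rfl⟩ : ∃ r', r = r' + 1 := ⟨r - 1, by simp at hl; omega⟩
    obtain ⟨e, he, y, hy, hxy⟩ := ih r (by simpa using hl) fun u hu => hlS u (by simp [hu])
    rw [Set.mem_Iic] at he
    have hpow : (r + 1) ^ m ≤ (r + 1 + 1) ^ m := Nat.pow_le_pow_left (by omega) m
    rw [List.prod_cons, ← hxy]
    rcases hlS s (by simp) with rfl | hs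
    · refine ⟨e + 1, by simp [he], y, monoidBall_mono subset_rfl ?_ hy, ?_⟩
      · exact Nat.mul_le_mul (by omega) hpow
      · simp only [pow_succ', mul_assoc]
    · refine ⟨e, by simp; omega, _, monoidBall_mono subset_rfl ?_ (mul_mem_monoidBall
        (conj_pow_mem_monoidBall m (hS s hs) (hm s hs) e) hy), by simp only; group⟩
      have : (e + 1) ^ m ≤ (r + 1 + 1) ^ m := Nat.pow_le_pow_left (by omega) m
      nlinarith

theorem HasPolynomialMonoidGrowth.insert {t : G} {S S' : Set G} (m : ℕ)
    (h : HasPolynomialMonoidGrowth S') (hS : ∀ s ∈ S, ∀ j < m, (conjDiff t)^[j] s ∈ S')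
    (hm : ∀ s ∈ S, (conjDiff t)^[m] s = 1) : HasPolynomialMonoidGrowth (insert t S) := by
  obtain ⟨C, k, hC⟩ := h
  refine ⟨C, (m + 1) * k + 1, fun r => ?_⟩
  have hIic : (Set.Iic r).encard = ((r + 1 : ℕ) : ℕ∞) := by
    rw [← Finset.coe_Iic, Set.encard_coe_eq_coe_finsetCard, Nat.card_Iic]
  refine (Set.encard_le_encard (monoidBall_insert_subset m hS hm r)).trans
    ((encard_image2_le_mul _ _ _).trans ?_)
  rw [hIic]
  refine (mul_le_mul_right (hC _) _).trans ?_
  rw [← Nat.cast_mul, Nat.cast_le]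
  have hle : r * (r + 1) ^ m + 1 ≤ (r + 1) ^ (m + 1) := by
    have : 1 ≤ (r + 1) ^ m := Nat.one_le_pow _ _ (by omega)
    rw [pow_succ]
    nlinarith
  calc (r + 1) * (C * (r * (r + 1) ^ m + 1) ^ k)
      ≤ (r + 1) * (C * ((r + 1) ^ (m + 1)) ^ k) := by gcongr
    _ = C * (r + 1) ^ ((m + 1) * k + 1) := by rw [← pow_mul]; ring

open scoped commutatorElement in
theorem conjDiff_mem_lowerCentralSeries (t : G) {s : G} {w : ℕ}
    (hs : s ∈ (⊤ : Subgroup G).lowerCentralSeries w) :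
    conjDiff t s ∈ (⊤ : Subgroup G).lowerCentralSeries (w + 1) := by
  have h : conjDiff t s = ⁅s⁻¹, t⁻¹⁆ := by
    rw [conjDiff, commutatorElement_def]
    group
  rw [h, Subgroup.lowerCentralSeries_succ]
  exact Subgroup.commutator_mem_commutator (inv_mem hs) (Subgroup.mem_top _)

theorem conjDiff_iterate_mem_lowerCentralSeries (t : G) {s : G} {w : ℕ}
    (hs : s ∈ (⊤ : Subgroup G).lowerCentralSeries w) (j : ℕ) :
    (conjDiff t)^[j] s ∈ (⊤ : Subgroup G).lowerCentralSeries (w + j) := by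
  induction j with
  | zero => exact hs
  | succ j ih =>
    rw [Function.iterate_succ_apply']
    exact conjDiff_mem_lowerCentralSeries t ih

theorem hasPolynomialMonoidGrowth_of_subset_bot {S : Set G} (hS : S ⊆ {1}) :
    HasPolynomialMonoidGrowth S := by
  refine ⟨1, 0, fun r => ?_⟩
  have : monoidBall S r ⊆ {1} := by
    rintro x ⟨l, -, hl, rfl⟩
    exact List.prod_eq_one fun t ht => hS (hl t ht)
  simpa using Set.encard_le_encard this

/-- Removing a generator of least depth in the lower central series only adds generators of
greater depth. -/
theorem hasPolynomialMonoidGrowth_union_of_lowerCentralSeries {n w : ℕ}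
    (hn : (⊤ : Subgroup G).lowerCentralSeries n = ⊥)
    (hw : ∀ S : Set G, S.Finite → S ⊆ (⊤ : Subgroup G).lowerCentralSeries (w + 1) →
      HasPolynomialMonoidGrowth S)
    (F : Set G) (hF : F.Finite) (hFw : F ⊆ (⊤ : Subgroup G).lowerCentralSeries w)
    (S : Set G) (hS : S.Finite) (hSw : S ⊆ (⊤ : Subgroup G).lowerCentralSeries (w + 1)) :
    HasPolynomialMonoidGrowth (F ∪ S) := by
  induction F, hF using Set.Finite.induction_on generalizing S with
  | empty => simpa using hw S hS hSw
  | @insert t F ht hF ih =>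
    rw [Set.insert_subset_iff] at hFw
    have hanti := (⊤ : Subgroup G).lowerCentralSeries_antitone
    have hFS : F ∪ S ⊆ (⊤ : Subgroup G).lowerCentralSeries w :=
      Set.union_subset hFw.2 (hSw.trans (hanti w.le_succ))
    rw [Set.insert_union]
    refine (ih hFw.2 (S ∪ ⋃ j ∈ Set.Iio n, (conjDiff t)^[j + 1] '' (F ∪ S)) ?_ ?_).insert n ?_ ?_
    · exact hS.union ((Set.finite_Iio n).biUnion fun j _ => (hF.union hS).image _)
    · refine Set.union_subset hSw (Set.iUnion₂_subset fun j _ => ?_)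
      rintro _ ⟨s, hs, rfl⟩
      exact hanti (by omega) (conjDiff_iterate_mem_lowerCentralSeries t (hFS hs) (j + 1))
    · rintro s hs (_ | j) hj
      · exact hs.imp id Or.inl
      · refine Or.inr (Or.inr (Set.mem_biUnion (Set.mem_Iio.2 (by omega : j < n)) ?_))
        exact ⟨s, hs, rfl⟩
    · intro s hs
      have := hanti (Nat.le_add_left n w) (conjDiff_iterate_mem_lowerCentralSeries t (hFS hs) n)
      rwa [hn, Subgroup.mem_bot] at this

/-- Finite subsets of nilpotent groups have polynomial growth. -/
theorem hasPolynomialMonoidGrowth_of_isNilpotent (hG : Group.IsNilpotent G) {S : Set G}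
    (hS : S.Finite) : HasPolynomialMonoidGrowth S := by
  obtain ⟨n, hn⟩ := Subgroup.nilpotent_iff_lowerCentralSeries.1 hG
  have key : ∀ d w : ℕ, w + d = n → ∀ S : Set G, S.Finite →
      S ⊆ (⊤ : Subgroup G).lowerCentralSeries w → HasPolynomialMonoidGrowth S := by
    intro d
    induction d with
    | zero =>
      rintro w rfl S - hSw
      refine hasPolynomialMonoidGrowth_of_subset_bot fun s hs => ?_
      have := hSw hs
      rw [add_zero] at hn
      rwa [hn] at this
    | succ d ih =>
      intro w hw S hS hSw
      simpa using hasPolynomialMonoidGrowth_union_of_lowerCentralSeries hn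
        (ih (w + 1) (by omega)) S hS hSw ∅ Set.finite_empty (Set.empty_subset _)
  exact key n 0 (by omega) S hS fun _ _ => Subgroup.mem_top _

/-- The Schreier element of `H` attached to `t` and a left coset of `H`. -/
noncomputable def schreierElement (H : Subgroup G) (t : G) (q : G ⧸ H) : H :=
  ⟨((t * q.out : G) : G ⧸ H).out⁻¹ * (t * q.out), QuotientGroup.eq.1 (Quotient.out_eq' _)⟩

theorem monoidBall_subset_image2_schreierElement (H : Subgroup G) (T : Set G) (r : ℕ) :
    monoidBall T r ⊆
      Set.image2 (fun (q : G ⧸ H) (k : H) => q.out * k * ((1 : G) : G ⧸ H).out⁻¹) Set.univ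
        (monoidBall (Set.image2 (schreierElement H) T Set.univ) r) := by
  rintro x ⟨l, hl, hlT, rfl⟩
  induction l generalizing r with
  | nil => exact ⟨((1 : G) : G ⧸ H), trivial, 1, one_mem_monoidBall _ _, by simp⟩
  | cons t l ih =>
    obtain ⟨r, rfl⟩ : ∃ r', r = r' + 1 := ⟨r - 1, by simp at hl; omega⟩
    obtain ⟨q, -, k, hk, hqk⟩ := ih r (by simpa using hl) fun u hu => hlT u (by simp [hu])
    have ht : schreierElement H t q ∈ Set.image2 (schreierElement H) T Set.univ :=
      Set.mem_image2_of_mem (hlT t (by simp)) trivial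
    refine ⟨((t * q.out : G) : G ⧸ H), trivial, schreierElement H t q * k, ?_, ?_⟩
    · exact add_comm 1 r ▸ mul_mem_monoidBall (mem_monoidBall_one ht) hk
    · simp only [List.prod_cons, ← hqk, Subgroup.coe_mul, schreierElement]
      group

/-- Finite subsets of virtually nilpotent groups have polynomial growth. -/
theorem hasPolynomialMonoidGrowth_of_finiteIndex (H : Subgroup G) [H.FiniteIndex]
    (hH : Group.IsNilpotent H) {T : Set G} (hT : T.Finite) : HasPolynomialMonoidGrowth T := by
  have := Subgroup.finite_quotient_of_finiteIndex (H := H)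
  obtain ⟨C, k, hC⟩ := hasPolynomialMonoidGrowth_of_isNilpotent hH
    (hT.image2 (schreierElement H) Set.finite_univ)
  refine ⟨Nat.card (G ⧸ H) * C, k, fun r => ?_⟩
  refine (Set.encard_le_encard (monoidBall_subset_image2_schreierElement H T r)).trans
    ((encard_image2_le_mul _ _ _).trans ((mul_le_mul_right (hC r) _).trans ?_))
  rw [Set.encard_univ, ENat.card_eq_coe_natCard, ← Nat.cast_mul, mul_assoc]

/-- On the coset group of a finitely generated virtually nilpotent group `G` by a finite
group `A` of automorphisms, every `n`-valued dynamic `T_z` has a polynomial growth function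
`ξ(r) = Nat.card (π '' (h · W_r(T)))` at every point. -/
theorem cosetGroup_dynamic_polynomial_growth (hfg : Group.FG G)
    (H : Subgroup G) (hHfi : H.FiniteIndex) (hHnilp : Group.IsNilpotent H)
    (A : Subgroup (MulAut G)) (hAfin : Finite A) (g h : G) :
    ∃ C k : ℕ, 0 < C ∧ ∀ r : ℕ, 1 ≤ r →
      Nat.card (orbitMap A '' ((fun w => h * w) '' wordSet {x | ∃ a ∈ A, a g = x} r)) ≤
        C * r ^ k := by
  have hT : {x | ∃ a ∈ A, a g = x}.Finite :=
    (Set.toFinite (A : Set (MulAut G))).image fun a : MulAut G => a g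
  obtain ⟨C, k, hC⟩ := hasPolynomialMonoidGrowth_of_finiteIndex H hHnilp hT
  refine ⟨(C + 1) * 2 ^ k, k, by positivity, fun r hr => ?_⟩
  have hsub : wordSet {x | ∃ a ∈ A, a g = x} r ⊆ monoidBall {x | ∃ a ∈ A, a g = x} r := by
    rintro x ⟨l, hl, hlT, rfl⟩
    exact ⟨l, hl.le, hlT, rfl⟩
  have hcard := ((Set.encard_image_le (orbitMap A) _).trans
    ((Set.encard_image_le (fun w => h * w) _).trans (Set.encard_le_encard hsub))).trans (hC r)
  rw [Nat.card_coe_set_eq]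
  refine (Set.encard_le_coe_iff_finite_ncard_le.1 hcard).2.trans ?_
  calc C * (r + 1) ^ k ≤ (C + 1) * (2 * r) ^ k := by gcongr <;> omega
    _ = (C + 1) * 2 ^ k * r ^ k := by rw [mul_pow, mul_assoc]
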